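/- Let m_𝔳 be a positive even integer and m_𝔷 a positive integer; set n = m_𝔳 + m_𝔷 + 1 and Q = m_𝔳/2 + m_𝔷. Let A(s) = 2^{m_𝔳 + m_𝔷} (sinh(s/2))^{m_𝔳 + m_𝔷} (cosh(s/2))^{m_𝔷} and w(λ) = λ²(1 + λ)^{n−3}. Let B > 2 and 0 < R₀ < 2. Then there exists c > 0, depending only on m_𝔳, m_𝔷, B and R₀, such that for every Lebesgue-measurable t : (0,∞) → (0, 4/Q²) and every measurable g : (0,∞) → ℂ with ∫_0^∞ (λ² + Q²/4)^{1/4} |g(λ)|² w(λ) dλ < ∞: ∫_0^{R₀} A(s)^{1/2} | ∫_{B/s}^∞ λ^{-(n−1)/2} e^{i(λ s + t(s)(λ² + Q²/4))} g(λ) w(λ) dλ | ds ≤ c ( ∫_0^∞ (λ² + Q²/4)^{1/4} |g(λ)|² w(λ) dλ )^{1/2}. -/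

import Mathlib

open MeasureTheory
open scoped ENNReal NNReal

/-- The homogeneous dimension `Q = mv/2 + mz` of a Damek-Ricci space. -/
noncomputable def homDim (mv mz : ℕ) : ℝ := (mv : ℝ) / 2 + (mz : ℝ)

/-- The radial density `A(s) = 2^{mv+mz} sinh(s/2)^{mv+mz} cosh(s/2)^{mz}` of the left Haar
measure of a Damek-Ricci space with `dim 𝔳 = mv`, `dim 𝔷 = mz`. -/
noncomputable def radialDensity (mv mz : ℕ) (s : ℝ) : ℝ :=
  2 ^ (mv + mz) * Real.sinh (s / 2) ^ (mv + mz) * Real.cosh (s / 2) ^ mz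

/-- The Plancherel weight `w(λ) = λ²(1+λ)^{n-3}`, `n = mv + mz + 1`. -/
noncomputable def plancherelWeight (mv mz : ℕ) (l : ℝ) : ℝ :=
  l ^ 2 * (1 + l) ^ ((mv : ℝ) + (mz : ℝ) + 1 - 3)

/-- The oscillatory integral of `l^{-1/2} e^{i(xl + τ(l²+q))}` over `[a, b]`. -/
noncomputable def oscInt (x τ q a b : ℝ) : ℂ :=
  ∫ l in a..b, ((l ^ (-(1 / 2 : ℝ)) : ℝ) : ℂ) *
    Complex.exp (Complex.I * ((x * l + τ * (l ^ 2 + q) : ℝ) : ℂ))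

lemma oscInt_intervalIntegrable (x τ q : ℝ) {a b : ℝ} (ha : 0 < a) (hb : 0 < b) :
    IntervalIntegrable (fun l : ℝ => ((l ^ (-(1 / 2 : ℝ)) : ℝ) : ℂ) *
      Complex.exp (Complex.I * ((x * l + τ * (l ^ 2 + q) : ℝ) : ℂ))) volume a b := by
  apply ContinuousOn.intervalIntegrable
  have h : ∀ l ∈ Set.uIcc a b, l ≠ 0 := fun l hl =>
    ((lt_min ha hb).trans_le hl.1).ne'
  apply ContinuousOn.mul
  · apply Complex.continuous_ofReal.comp_continuousOn
    exact ContinuousOn.rpow_const continuousOn_id fun l hl => Or.inl (h l hl)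
  · fun_prop

lemma norm_oscInt_le_sqrt_sub (x τ q : ℝ) {a b : ℝ} (ha : 0 < a) (hab : a ≤ b) :
    ‖oscInt x τ q a b‖ ≤ 2 * √b - 2 * √a := by
  have hd : ∀ l ∈ Set.uIcc a b, HasDerivAt (fun l : ℝ => 2 * √l) (l ^ (-(1 / 2 : ℝ))) l := by
    intro l hl
    rw [Set.uIcc_of_le hab] at hl
    have hl0 : 0 < l := ha.trans_le hl.1
    refine ((Real.hasDerivAt_sqrt hl0.ne').const_mul 2).congr_deriv ?_
    rw [Real.rpow_neg hl0.le, ← Real.sqrt_eq_rpow]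
    field_simp
  have hi : IntervalIntegrable (fun l : ℝ => l ^ (-(1 / 2 : ℝ))) volume a b := by
    apply ContinuousOn.intervalIntegrable
    apply ContinuousOn.rpow_const continuousOn_id
    intro l hl
    rw [Set.uIcc_of_le hab] at hl
    exact Or.inl (ha.trans_le hl.1).ne'
  rw [← intervalIntegral.integral_eq_sub_of_hasDerivAt hd hi]
  apply intervalIntegral.norm_integral_le_of_norm_le hab _ hi
  filter_upwards with l hl
  rw [norm_mul, Complex.norm_exp_I_mul_ofReal, mul_one, Complex.norm_real,
    Real.norm_of_nonneg (Real.rpow_nonneg (ha.trans hl.1).le _)]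

/-- First-derivative van der Corput estimate. -/
lemma norm_oscInt_le_of_le_deriv (x τ q : ℝ) {a b δ : ℝ} (ha : 0 < a) (hab : a ≤ b) (hδ : 0 < δ)
    (hp : ∀ l ∈ Set.Icc a b, δ ≤ |x + 2 * τ * l|) :
    ‖oscInt x τ q a b‖ ≤ 5 / (δ * √a) := by
  have hpos : ∀ l ∈ Set.uIcc a b, 0 < l := by
    intro l hl
    rw [Set.uIcc_of_le hab] at hl
    exact ha.trans_le hl.1
  have hpδ : ∀ l ∈ Set.uIcc a b, δ ≤ |x + 2 * τ * l| := by rwa [Set.uIcc_of_le hab]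
  have hp0 : ∀ l ∈ Set.uIcc a b, x + 2 * τ * l ≠ 0 := fun l hl =>
    abs_pos.1 (hδ.trans_le (hpδ l hl))
  obtain ⟨ς, hς, hτ⟩ : ∃ ς : ℝ, |ς| = 1 ∧ |τ| = ς * τ := by
    rcases le_total 0 τ with h | h
    · exact ⟨1, by simp, by simp [abs_of_nonneg h]⟩
    · exact ⟨-1, by simp, by simp [abs_of_nonpos h]⟩
  have hrpow : ∀ l ∈ Set.uIcc a b,
      HasDerivAt (fun l : ℝ => l ^ (-(1 / 2 : ℝ))) (-(1 / 2) * l ^ (-(3 / 2 : ℝ))) l := by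
    intro l hl
    refine (Real.hasDerivAt_rpow_const (Or.inl (hpos l hl).ne')).congr_deriv ?_
    norm_num
  have hinv : ∀ l ∈ Set.uIcc a b,
      HasDerivAt (fun l : ℝ => (x + 2 * τ * l)⁻¹) (-(2 * τ) / (x + 2 * τ * l) ^ 2) l := by
    intro l hl
    have : HasDerivAt (fun l : ℝ => x + 2 * τ * l) (2 * τ) l := by
      simpa using ((hasDerivAt_id l).const_mul (2 * τ)).const_add x
    exact this.fun_inv (hp0 l hl)
  have c1 : ∀ r : ℝ, ContinuousOn (fun l : ℝ => l ^ r) (Set.uIcc a b) := fun r =>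
    ContinuousOn.rpow_const continuousOn_id fun l hl => Or.inl (hpos l hl).ne'
  have c2 : ContinuousOn (fun l : ℝ => (x + 2 * τ * l)⁻¹) (Set.uIcc a b) :=
    ContinuousOn.inv₀ (by fun_prop) hp0
  have c3 : ∀ r : ℝ, ContinuousOn (fun l : ℝ => r / (x + 2 * τ * l) ^ 2) (Set.uIcc a b) :=
    fun r => ContinuousOn.div₀ (by fun_prop) (by fun_prop) fun l hl => pow_ne_zero _ (hp0 l hl)
  set u' : ℝ → ℝ := fun l => -(1 / 2) * l ^ (-(3 / 2 : ℝ)) * (x + 2 * τ * l)⁻¹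
    + l ^ (-(1 / 2 : ℝ)) * (-(2 * τ) / (x + 2 * τ * l) ^ 2) with hu'
  have hu : ∀ l ∈ Set.uIcc a b, HasDerivAt
      (fun l : ℝ => ((l ^ (-(1 / 2 : ℝ)) * (x + 2 * τ * l)⁻¹ : ℝ) : ℂ)) ((u' l : ℝ) : ℂ) l :=
    fun l hl => ((hrpow l hl).mul (hinv l hl)).ofReal_comp
  have hu'c : ContinuousOn u' (Set.uIcc a b) :=
    (((c1 _).const_mul _).mul c2).add ((c1 _).mul (c3 _))
  have hv : ∀ l ∈ Set.uIcc a b, HasDerivAt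
      (fun l : ℝ => Complex.exp (Complex.I * ((x * l + τ * (l ^ 2 + q) : ℝ) : ℂ)))
      (Complex.exp (Complex.I * ((x * l + τ * (l ^ 2 + q) : ℝ) : ℂ)) *
        (Complex.I * ((x + 2 * τ * l : ℝ) : ℂ))) l := by
    intro l _
    have h1 : HasDerivAt (fun l : ℝ => x * l + τ * (l ^ 2 + q)) (x + 2 * τ * l) l := by
      have := ((hasDerivAt_id l).const_mul x).add
        ((((hasDerivAt_id l).pow 2).add_const q).const_mul τ)
      refine this.congr_deriv ?_
      simp; ring
    exact (h1.ofReal_comp.const_mul Complex.I).cexp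
  have hparts := intervalIntegral.integral_mul_deriv_eq_deriv_mul hu hv
    (ContinuousOn.intervalIntegrable (Complex.continuous_ofReal.comp_continuousOn hu'c))
    (Continuous.intervalIntegrable (by fun_prop) _ _)
  have hL : (∫ l in a..b, ((l ^ (-(1 / 2 : ℝ)) * (x + 2 * τ * l)⁻¹ : ℝ) : ℂ) *
      (Complex.exp (Complex.I * ((x * l + τ * (l ^ 2 + q) : ℝ) : ℂ)) *
        (Complex.I * ((x + 2 * τ * l : ℝ) : ℂ)))) = Complex.I * oscInt x τ q a b := by
    rw [oscInt, ← intervalIntegral.integral_const_mul]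
    apply intervalIntegral.integral_congr
    intro l hl
    have : ((x + 2 * τ * l : ℝ) : ℂ) ≠ 0 := Complex.ofReal_ne_zero.2 (hp0 l hl)
    simp only [Complex.ofReal_mul, Complex.ofReal_inv]
    field_simp
  rw [hL] at hparts
  have hn : ‖oscInt x τ q a b‖ = ‖Complex.I * oscInt x τ q a b‖ := by simp
  have hsa : a ^ (-(1 / 2 : ℝ)) = (√a)⁻¹ := by rw [Real.rpow_neg ha.le, ← Real.sqrt_eq_rpow]
  have hsa0 : 0 < (√a)⁻¹ := inv_pos.2 (Real.sqrt_pos.2 ha)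
  have hmono : ∀ l ∈ Set.uIcc a b, l ^ (-(1 / 2 : ℝ)) ≤ (√a)⁻¹ := by
    intro l hl
    rw [← hsa]
    rw [Set.uIcc_of_le hab] at hl
    exact Real.rpow_le_rpow_of_nonpos ha hl.1 (by norm_num)
  have hinvle : ∀ l ∈ Set.uIcc a b, |(x + 2 * τ * l)⁻¹| ≤ δ⁻¹ := by
    intro l hl
    rw [abs_inv]
    exact inv_anti₀ hδ (hpδ l hl)
  have hbdry : ∀ l ∈ Set.uIcc a b, ‖((l ^ (-(1 / 2 : ℝ)) * (x + 2 * τ * l)⁻¹ : ℝ) : ℂ) *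
      Complex.exp (Complex.I * ((x * l + τ * (l ^ 2 + q) : ℝ) : ℂ))‖ ≤ (√a)⁻¹ * δ⁻¹ := by
    intro l hl
    rw [norm_mul, Complex.norm_exp_I_mul_ofReal, mul_one, Complex.norm_real, norm_mul,
      Real.norm_of_nonneg (Real.rpow_nonneg (hpos l hl).le _)]
    exact mul_le_mul (hmono l hl) (hinvle l hl) (abs_nonneg _) hsa0.le
  set m : ℝ → ℝ := fun l => δ⁻¹ * (1 / 2 * l ^ (-(3 / 2 : ℝ))) +
    (√a)⁻¹ * (ς * (2 * τ) / (x + 2 * τ * l) ^ 2) with hm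
  have hmc : IntervalIntegrable m volume a b :=
    ContinuousOn.intervalIntegrable ((((c1 _).const_mul _).const_mul _).add ((c3 _).const_mul _))
  have hH : ∀ l ∈ Set.uIcc a b, HasDerivAt
      (fun l : ℝ => -δ⁻¹ * l ^ (-(1 / 2 : ℝ)) + (-((√a)⁻¹ * ς)) * (x + 2 * τ * l)⁻¹) (m l) l := by
    intro l hl
    refine (((hrpow l hl).const_mul _).add ((hinv l hl).const_mul _)).congr_deriv ?_
    simp only [hm]; ring
  have hbound : ‖∫ l in a..b, ((u' l : ℝ) : ℂ) *
      Complex.exp (Complex.I * ((x * l + τ * (l ^ 2 + q) : ℝ) : ℂ))‖ ≤ ∫ l in a..b, m l := by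
    apply intervalIntegral.norm_integral_le_of_norm_le hab _ hmc
    filter_upwards with l hl
    have hl' : l ∈ Set.uIcc a b := by rw [Set.uIcc_of_le hab]; exact ⟨hl.1.le, hl.2⟩
    rw [norm_mul, Complex.norm_exp_I_mul_ofReal, mul_one, Complex.norm_real]
    refine (norm_add_le _ _).trans (add_le_add ?_ ?_)
    · rw [norm_mul, norm_mul, Real.norm_of_nonneg (Real.rpow_nonneg (hpos l hl').le _), mul_comm]
      refine mul_le_mul (hinvle l hl') (le_of_eq (by norm_num)) ?_ (inv_pos.2 hδ).le
      exact mul_nonneg (norm_nonneg _) (Real.rpow_nonneg (hpos l hl').le _)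
    · rw [norm_mul, Real.norm_of_nonneg (Real.rpow_nonneg (hpos l hl').le _)]
      refine mul_le_mul (hmono l hl') (le_of_eq ?_) (norm_nonneg _) hsa0.le
      rw [norm_div, norm_neg, norm_pow, Real.norm_eq_abs, Real.norm_eq_abs, sq_abs, abs_mul, hτ,
        abs_two]
      ring
  rw [intervalIntegral.integral_eq_sub_of_hasDerivAt hH hmc] at hbound
  have hae : a ∈ Set.uIcc a b := Set.left_mem_uIcc
  have hbe : b ∈ Set.uIcc a b := Set.right_mem_uIcc
  have hfin : ∀ l ∈ Set.uIcc a b, |(-((√a)⁻¹ * ς)) * (x + 2 * τ * l)⁻¹| ≤ (√a)⁻¹ * δ⁻¹ := by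
    intro l hl
    rw [abs_mul, abs_neg, abs_mul, hς, mul_one, abs_of_pos hsa0]
    exact mul_le_mul_of_nonneg_left (hinvle l hl) hsa0.le
  have e1 := abs_le.1 (hfin a hae)
  have e2 := abs_le.1 (hfin b hbe)
  have e3 : 0 ≤ δ⁻¹ * b ^ (-(1 / 2 : ℝ)) :=
    mul_nonneg (inv_pos.2 hδ).le (Real.rpow_nonneg (hpos b hbe).le _)
  have e4 : 5 / (δ * √a) = 5 * ((√a)⁻¹ * δ⁻¹) := by
    rw [div_eq_mul_inv, mul_inv]; ring
  rw [hn, hparts, e4]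
  refine (norm_sub_le _ _).trans ?_
  have e5 := (norm_sub_le _ _).trans (add_le_add (hbdry b hbe) (hbdry a hae))
  rw [hsa] at hbound
  nlinarith [e5, hbound, e1.1, e2.2]

/-- Every oscillatory integral over a subinterval of `[l, r] ∩ (0, ∞)` is at most `M`. -/
def OscBound (x τ q l r M : ℝ) : Prop :=
  ∀ a b, 0 < a → l ≤ a → a ≤ b → b ≤ r → ‖oscInt x τ q a b‖ ≤ M

lemma OscBound.append {x τ q l m r M₁ M₂ : ℝ} (hM₁ : 0 ≤ M₁) (hM₂ : 0 ≤ M₂)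
    (h₁ : OscBound x τ q l m M₁) (h₂ : OscBound x τ q m r M₂) :
    OscBound x τ q l r (M₁ + M₂) := by
  intro a b ha hla hab hbr
  rcases le_total b m with hbm | hmb
  · exact (h₁ a b ha hla hab hbm).trans (by linarith)
  rcases le_total m a with hma | ham
  · exact (h₂ a b ha hma hab hbr).trans (by linarith)
  have hm : 0 < m := ha.trans_le ham
  have : oscInt x τ q a b = oscInt x τ q a m + oscInt x τ q m b :=
    (intervalIntegral.integral_add_adjacent_intervals
      (oscInt_intervalIntegrable x τ q ha hm)
      (oscInt_intervalIntegrable x τ q hm (hm.trans_le hmb))).symm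
  rw [this]
  exact (norm_add_le _ _).trans
    (add_le_add (h₁ a m ha hla ham le_rfl) (h₂ m b hm le_rfl hmb hbr))

lemma oscBound_inv_abs (x τ q : ℝ) : OscBound x τ q 0 |x|⁻¹ (2 / √|x|) := by
  intro a b ha _ hab hb
  have h1 := norm_oscInt_le_sqrt_sub x τ q ha hab
  have h2 : √b ≤ (√|x|)⁻¹ := by rw [← Real.sqrt_inv]; exact Real.sqrt_le_sqrt hb
  have h3 := Real.sqrt_nonneg a
  rw [div_eq_mul_inv]
  linarith

lemma oscBound_of_le_deriv {x τ q l r δ M : ℝ} (hδ : 0 < δ) (hl : 0 < l)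
    (hp : ∀ y, l ≤ y → y ≤ r → δ ≤ |x + 2 * τ * y|) (hM : 5 / (δ * √l) ≤ M) :
    OscBound x τ q l r M := by
  intro a b ha hla hab hbr
  refine (norm_oscInt_le_of_le_deriv x τ q ha hab hδ
    fun y hy => hp y (hla.trans hy.1) (hy.2.trans hbr)).trans (le_trans ?_ hM)
  have := Real.sqrt_pos.2 hl
  gcongr

/-- The oscillatory integral is bounded by a multiple of `|x|^{-1/2}`, uniformly in the quadratic
coefficient and in the interval of integration. -/
lemma norm_oscInt_le {x : ℝ} (τ q : ℝ) {a b : ℝ} (hx : x ≠ 0) (ha : 0 < a) (hab : a ≤ b) :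
    ‖oscInt x τ q a b‖ ≤ 50 / √|x| := by
  have hx' : 0 < |x| := abs_pos.2 hx
  set X := √|x| with hX
  have hX0 : 0 < X := Real.sqrt_pos.2 hx'
  have hXX : X * X = |x| := Real.mul_self_sqrt hx'.le
  have hinv : √(|x|⁻¹) = X⁻¹ := Real.sqrt_inv _
  have hnn : ∀ k : ℝ, 0 ≤ k → 0 ≤ k / X := fun k hk => div_nonneg hk hX0.le
  have h0 : OscBound x τ q 0 |x|⁻¹ (2 / X) := oscBound_inv_abs x τ q
  rcases le_or_gt 0 (x * τ) with hxt | hxt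
  · have h1 : OscBound x τ q |x|⁻¹ b (5 / X) := by
      refine oscBound_of_le_deriv hx' (inv_pos.2 hx') ?_ ?_
      · intro y hy _
        have hy0 : 0 ≤ y := (inv_pos.2 hx').le.trans hy
        apply sq_le_sq.1
        nlinarith [mul_nonneg hxt hy0, sq_nonneg (τ * y)]
      · rw [hinv, ← hXX]; apply le_of_eq; field_simp
    refine ((h0.append (hnn 2 (by norm_num)) (hnn 5 (by norm_num)) h1) a b ha ha.le hab
      le_rfl).trans ?_
    rw [← add_div]; gcongr; norm_num
  have hτ : τ ≠ 0 := by rintro rfl; simp at hxt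
  obtain ⟨c, hc0, hc⟩ : ∃ c : ℝ, 0 < c ∧ x = -(2 * τ * c) := by
    refine ⟨-x / (2 * τ), ?_, by field_simp⟩
    have : -x / (2 * τ) = -(x * τ) / (2 * τ ^ 2) := by field_simp
    rw [this]; have := sq_pos_of_ne_zero hτ; apply div_pos <;> linarith
  have hp : ∀ y, |x + 2 * τ * y| = |x| / c * |y - c| := by
    intro y
    have e : |x| / c = |2 * τ| := by
      rw [hc, abs_neg, abs_mul, abs_of_pos hc0]; field_simp
    rw [e, ← abs_mul, hc]; congr 1; ring
  have hsc : 0 < √c := Real.sqrt_pos.2 hc0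
  have hscc : √c * √c = c := Real.mul_self_sqrt hc0.le
  have hη : 0 < √c / X := div_pos hsc hX0
  have h1 : OscBound x τ q |x|⁻¹ (c / 2) (10 / X) := by
    refine oscBound_of_le_deriv (half_pos hx') (inv_pos.2 hx') ?_ ?_
    · intro y _ hy
      rw [hp, abs_of_nonpos (a := y - c) (by linarith), div_mul_eq_mul_div, le_div_iff₀ hc0]
      nlinarith
    · rw [hinv, ← hXX]; apply le_of_eq; field_simp; norm_num
  have hs2 : √c / 2 ≤ √(c / 2) := by
    apply Real.le_sqrt_of_sq_le
    rw [div_pow, Real.sq_sqrt hc0.le]; linarith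
  have hδ : 0 < |x| / c * (√c / X) := by positivity
  have hδe : |x| / c * (√c / X) = X / √c := by
    rw [← hXX]; nth_rw 1 [← hscc]; field_simp
  have h2 : OscBound x τ q (c / 2) (c - √c / X) (10 / X) := by
    refine oscBound_of_le_deriv hδ (half_pos hc0) ?_ ?_
    · intro y _ hy
      rw [hp, abs_of_nonpos (a := y - c) (by linarith)]
      gcongr; linarith
    · rw [hδe]
      calc 5 / (X / √c * √(c / 2)) ≤ 5 / (X / √c * (√c / 2)) := by gcongr
        _ = 10 / X := by field_simp; norm_num
  have h4 : OscBound x τ q (c + √c / X) b (5 / X) := by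
    refine oscBound_of_le_deriv hδ (by linarith) ?_ ?_
    · intro y hy _
      rw [hp, abs_of_nonneg (a := y - c) (by linarith)]
      gcongr; linarith
    · rw [hδe]
      calc 5 / (X / √c * √(c + √c / X)) ≤ 5 / (X / √c * √c) := by gcongr; linarith
        _ = 5 / X := by field_simp
  have h3 : OscBound x τ q (c - √c / X) (c + √c / X) (4 / X) := by
    intro s t hs hls hst htr
    refine (norm_oscInt_le_sqrt_sub x τ q hs hst).trans ?_
    have hss := Real.mul_self_sqrt hs.le
    have htt := Real.mul_self_sqrt (hs.le.trans hst)
    have hs0 := Real.sqrt_pos.2 hs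
    have hst' := Real.sqrt_le_sqrt hst
    rcases le_total t c with htc | hct
    · have k1 : √t ≤ √c := Real.sqrt_le_sqrt htc
      have k2 : √s ≤ √c := hst'.trans k1
      have : (√c - √s) * √c ≤ (1 / X) * √c := by
        have : √c / X = 1 / X * √c := by ring
        nlinarith
      have := le_of_mul_le_mul_right this hsc
      have e : 4 / X = 4 * (1 / X) := by ring
      have := hnn 1 (by norm_num)
      linarith
    · have k1 : √c ≤ √t := Real.sqrt_le_sqrt hct
      have : (√t - √s) * √c ≤ (2 / X) * √c := by
        have : √c / X = 1 / X * √c := by ring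
        have e : 2 / X = 2 * (1 / X) := by ring
        rw [e]
        nlinarith
      have := le_of_mul_le_mul_right this hsc
      have e : 4 / X = 2 * (2 / X) := by ring
      linarith
  have h01 := h0.append (hnn 2 (by norm_num)) (hnn 10 (by norm_num)) h1
  rw [← add_div] at h01
  have h012 := h01.append (hnn _ (by norm_num)) (hnn 10 (by norm_num)) h2
  rw [← add_div] at h012
  have h03 := h012.append (hnn _ (by norm_num)) (hnn 4 (by norm_num)) h3
  rw [← add_div] at h03
  have h04 := h03.append (hnn _ (by norm_num)) (hnn 5 (by norm_num)) h4
  rw [← add_div] at h04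
  refine (h04 a b ha ha.le hab le_rfl).trans ?_
  gcongr; norm_num

section Duality

variable {μ ν : Measure ℝ} [IsFiniteMeasure μ] [IsFiniteMeasure ν] {e : ℝ → ℝ → ℂ}

open ComplexConjugate

lemma lintegral_enorm_sq_adjoint_le (he : Measurable (Function.uncurry e))
    (he1 : ∀ s l, ‖e s l‖ ≤ 1) {k : ℝ → ℝ → ℝ≥0∞}
    (hk : ∀ s s', ‖∫ l, e s l * conj (e s' l) ∂ν‖ₑ ≤ k s s')
    {φ : ℝ → ℂ} (hφ : Measurable φ) (hφ1 : ∀ s, ‖φ s‖ ≤ 1) :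
    ∫⁻ l, ‖∫ s, φ s * e s l ∂μ‖ₑ ^ 2 ∂ν ≤ ∫⁻ s, ∫⁻ s', k s s' ∂μ ∂μ := by
  set Φ : ℝ → ℂ := fun l => ∫ s, φ s * e s l ∂μ with hΦ
  have hfe : ∀ s l, ‖φ s * e s l‖ ≤ 1 := fun s l => by
    rw [norm_mul]; exact mul_le_one₀ (hφ1 s) (norm_nonneg _) (he1 s l)
  have hΦm : StronglyMeasurable Φ := by
    apply StronglyMeasurable.integral_prod_left (f := fun s l => φ s * e s l)
    exact ((hφ.comp measurable_fst).mul he).stronglyMeasurable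
  have hΦb : ∀ l, ‖Φ l‖ ≤ μ.real Set.univ := fun l => by
    simpa using norm_integral_le_of_norm_le_const (μ := μ) (Filter.Eventually.of_forall
      fun s => hfe s l)
  have hΦi : Integrable (fun l => ‖Φ l‖ ^ 2) ν := by
    apply Integrable.of_bound (hΦm.norm.pow 2).aestronglyMeasurable ((μ.real Set.univ) ^ 2)
    filter_upwards with l
    rw [Pi.pow_apply, norm_pow, norm_norm]
    exact pow_le_pow_left₀ (norm_nonneg _) (hΦb l) 2
  set H : (ℝ × ℝ) → ℝ → ℂ := fun p l => (φ p.1 * e p.1 l) * conj (φ p.2 * e p.2 l) with hH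
  have hHm : Measurable (Function.uncurry H) := by
    have h1 : Measurable fun z : (ℝ × ℝ) × ℝ => e z.1.1 z.2 :=
      he.comp ((measurable_fst.comp measurable_fst).prodMk measurable_snd)
    have h2 : Measurable fun z : (ℝ × ℝ) × ℝ => e z.1.2 z.2 :=
      he.comp ((measurable_snd.comp measurable_fst).prodMk measurable_snd)
    have h3 : Measurable fun z : (ℝ × ℝ) × ℝ => φ z.1.1 :=
      hφ.comp (measurable_fst.comp measurable_fst)
    have h4 : Measurable fun z : (ℝ × ℝ) × ℝ => φ z.1.2 :=
      hφ.comp (measurable_snd.comp measurable_fst)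
    exact (h3.mul h1).mul (Complex.continuous_conj.measurable.comp (h4.mul h2))
  have hHb : ∀ p l, ‖H p l‖ ≤ 1 := fun p l => by
    simp only [hH]
    rw [norm_mul, RCLike.norm_conj]
    exact mul_le_one₀ (hfe _ _) (norm_nonneg _) (hfe _ _)
  have hHi : Integrable (Function.uncurry H) ((μ.prod μ).prod ν) :=
    Integrable.of_bound hHm.aestronglyMeasurable 1 (Filter.Eventually.of_forall fun z => hHb _ _)
  have hsq : ∀ l, ((‖Φ l‖ ^ 2 : ℝ) : ℂ) = ∫ p, H p l ∂(μ.prod μ) := by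
    intro l
    rw [integral_prod_mul (fun s => φ s * e s l) (fun s => conj (φ s * e s l)), integral_conj,
      Complex.mul_conj, Complex.normSq_eq_norm_sq]
  have hmain : ((∫ l, ‖Φ l‖ ^ 2 ∂ν : ℝ) : ℂ) = ∫ s, ∫ s', ∫ l, H (s, s') l ∂ν ∂μ ∂μ := by
    rw [← integral_complex_ofReal]
    simp_rw [hsq]
    rw [← integral_integral_swap hHi]
    rw [integral_prod]
    exact hHi.integral_prod_left
  have hlhs : ∫⁻ l, ‖Φ l‖ₑ ^ 2 ∂ν = ‖((∫ l, ‖Φ l‖ ^ 2 ∂ν : ℝ) : ℂ)‖ₑ := by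
    have h0 : 0 ≤ ∫ l, ‖Φ l‖ ^ 2 ∂ν := integral_nonneg fun l => sq_nonneg _
    rw [← ofReal_norm, Complex.norm_real, Real.norm_of_nonneg h0,
      ofReal_integral_eq_lintegral_ofReal hΦi (Filter.Eventually.of_forall fun l => sq_nonneg _)]
    congr 1 with l
    rw [ENNReal.ofReal_pow (norm_nonneg _), ofReal_norm]
  rw [hlhs, hmain]
  refine (enorm_integral_le_lintegral_enorm _).trans (lintegral_mono fun s => ?_)
  refine (enorm_integral_le_lintegral_enorm _).trans (lintegral_mono fun s' => ?_)
  have : ∫ l, H (s, s') l ∂ν = (φ s * conj (φ s')) * ∫ l, e s l * conj (e s' l) ∂ν := by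
    rw [← integral_const_mul]
    congr 1 with l
    simp only [hH, map_mul]; ring
  rw [this, enorm_mul]
  have h1 : ‖φ s * conj (φ s')‖ₑ ≤ 1 := by
    rw [← ofReal_norm, ENNReal.ofReal_le_one, norm_mul, RCLike.norm_conj]
    exact mul_le_one₀ (hφ1 s) (norm_nonneg _) (hφ1 s')
  calc _ ≤ 1 * k s s' := mul_le_mul' h1 (hk s s')
    _ = _ := one_mul _

/-- `T T^*` argument: a bound for the integrated kernel of `T T^*` bounds `T : L² → L¹`. -/
lemma lintegral_enorm_integral_le (he : Measurable (Function.uncurry e))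
    (he1 : ∀ s l, ‖e s l‖ ≤ 1) {k : ℝ → ℝ → ℝ≥0∞}
    (hk : ∀ s s', ‖∫ l, e s l * conj (e s' l) ∂ν‖ₑ ≤ k s s')
    {G : ℝ → ℂ} (hG : Integrable G ν) (hGm : Measurable G) :
    ∫⁻ s, ‖∫ l, e s l * G l ∂ν‖ₑ ∂μ ≤
      (∫⁻ s, ∫⁻ s', k s s' ∂μ ∂μ) ^ (1 / 2 : ℝ) * (∫⁻ l, ‖G l‖ₑ ^ 2 ∂ν) ^ (1 / 2 : ℝ) := by
  set F : ℝ → ℂ := fun s => ∫ l, e s l * G l ∂ν with hF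
  have hFm : StronglyMeasurable F := by
    apply StronglyMeasurable.integral_prod_right (f := fun s l => e s l * G l)
    exact (he.mul (hGm.comp measurable_snd)).stronglyMeasurable
  have hFb : ∀ s, ‖F s‖ ≤ ∫ l, ‖G l‖ ∂ν := fun s => by
    refine norm_integral_le_of_norm_le hG.norm (Filter.Eventually.of_forall fun l => ?_)
    rw [norm_mul]
    exact mul_le_of_le_one_left (norm_nonneg _) (he1 s l)
  have hFi : Integrable F μ :=
    Integrable.of_bound hFm.aestronglyMeasurable _ (Filter.Eventually.of_forall hFb)
  set φ : ℝ → ℂ := fun s => conj (F s) / (‖F s‖ : ℂ) with hφd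
  have hφ : Measurable φ :=
    (Complex.continuous_conj.measurable.comp hFm.measurable).div
      (Complex.measurable_ofReal.comp hFm.measurable.norm)
  have hφ1 : ∀ s, ‖φ s‖ ≤ 1 := fun s => by
    simp only [hφd]
    rw [norm_div, RCLike.norm_conj, Complex.norm_real, norm_norm]
    exact div_self_le_one _
  have hφF : ∀ s, φ s * F s = ((‖F s‖ : ℝ) : ℂ) := fun s => by
    simp only [hφd]
    rcases eq_or_ne (F s) 0 with h | h
    · simp [h]
    · have : (‖F s‖ : ℂ) ≠ 0 := by simpa using h
      rw [div_mul_eq_mul_div, mul_comm, Complex.mul_conj, Complex.normSq_eq_norm_sq,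
        Complex.ofReal_pow]
      field_simp
  have hi : Integrable (Function.uncurry fun s l => φ s * (e s l * G l)) (μ.prod ν) := by
    have h1 : Integrable (fun z : ℝ × ℝ => G z.2) (μ.prod ν) := hG.comp_snd μ
    refine h1.mono ?_ (Filter.Eventually.of_forall fun z => ?_)
    · exact ((hφ.comp measurable_fst).mul
        (he.mul (hGm.comp measurable_snd))).aestronglyMeasurable
    · simp only [Function.uncurry, norm_mul]
      calc _ ≤ 1 * (1 * ‖G z.2‖) := by
            gcongr
            · exact hφ1 _
            · exact he1 _ _
        _ = _ := by ring
  have hswap : ((∫ s, ‖F s‖ ∂μ : ℝ) : ℂ) = ∫ l, (∫ s, φ s * e s l ∂μ) * G l ∂ν := by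
    rw [← integral_complex_ofReal]
    calc ∫ s, ((‖F s‖ : ℝ) : ℂ) ∂μ = ∫ s, ∫ l, φ s * (e s l * G l) ∂ν ∂μ := by
          congr 1 with s
          rw [integral_const_mul]; exact (hφF s).symm
      _ = ∫ l, ∫ s, φ s * (e s l * G l) ∂μ ∂ν := integral_integral_swap hi
      _ = _ := by
          congr 1 with l
          rw [← integral_mul_const]
          congr 1 with s
          ring
  have hlhs : ∫⁻ s, ‖F s‖ₑ ∂μ = ‖((∫ s, ‖F s‖ ∂μ : ℝ) : ℂ)‖ₑ := by
    have h0 : 0 ≤ ∫ s, ‖F s‖ ∂μ := integral_nonneg fun s => norm_nonneg _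
    rw [← ofReal_norm, Complex.norm_real, Real.norm_of_nonneg h0,
      ofReal_integral_norm_eq_lintegral_enorm hFi]
  have hΦm : StronglyMeasurable fun l => ∫ s, φ s * e s l ∂μ := by
    apply StronglyMeasurable.integral_prod_left (f := fun s l => φ s * e s l)
    exact ((hφ.comp measurable_fst).mul he).stronglyMeasurable
  rw [hlhs, hswap]
  refine (enorm_integral_le_lintegral_enorm _).trans ?_
  simp_rw [enorm_mul]
  have hcs := ENNReal.lintegral_mul_le_Lp_mul_Lq ν Real.HolderConjugate.two_two
    hΦm.enorm.aemeasurable hGm.enorm.aemeasurable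
  simp only [Pi.mul_apply, ENNReal.rpow_two] at hcs
  refine hcs.trans ?_
  exact mul_le_mul_left (ENNReal.rpow_le_rpow
    (lintegral_enorm_sq_adjoint_le he he1 hk hφ hφ1) (by norm_num)) _

end Duality

lemma lintegral_enorm_rpow_neg_half_Ioc_lt_top (R : ℝ) :
    ∫⁻ u in Set.Ioc 0 R, ‖u‖ₑ ^ (-(1 / 2 : ℝ)) < ⊤ := by
  rcases le_or_gt R 0 with hR | hR
  · simp [Set.Ioc_eq_empty_of_le hR]
  have h := (intervalIntegral.intervalIntegrable_rpow' (a := 0) (b := R) (r := -(1 / 2 : ℝ))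
    (by norm_num)).1
  refine lt_of_eq_of_lt (setLIntegral_congr_fun measurableSet_Ioc fun u hu => ?_) h.2
  show ‖u‖ₑ ^ (-(1 / 2 : ℝ)) = ‖u ^ (-(1 / 2 : ℝ))‖ₑ
  rw [Real.enorm_eq_ofReal hu.1.le, Real.enorm_eq_ofReal (Real.rpow_nonneg hu.1.le _),
    ENNReal.ofReal_rpow_of_pos hu.1]

lemma lintegral_enorm_rpow_neg_half_Icc_lt_top (R : ℝ) :
    ∫⁻ u in Set.Icc (-R) R, ‖u‖ₑ ^ (-(1 / 2 : ℝ)) < ⊤ := by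
  have h := lintegral_enorm_rpow_neg_half_Ioc_lt_top R
  have hneg : ∫⁻ u in Set.Ico (-R) 0, ‖u‖ₑ ^ (-(1 / 2 : ℝ)) < ⊤ := by
    have hm := (Measure.measurePreserving_neg (volume : Measure ℝ)).setLIntegral_comp_preimage
      (measurableSet_Ioc (a := (0 : ℝ)) (b := R)) (f := fun u => ‖u‖ₑ ^ (-(1 / 2 : ℝ)))
      (measurable_enorm.pow_const _)
    have hs : Neg.neg ⁻¹' (Set.Ioc (0 : ℝ) R) = Set.Ico (-R) 0 := by simp
    rw [hs] at hm
    simp only [enorm_neg] at hm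
    rwa [hm]
  have hsub : Set.Icc (-R) R ⊆ Set.Ico (-R) 0 ∪ {0} ∪ Set.Ioc 0 R := by
    intro u hu
    rcases lt_trichotomy u 0 with h0 | h0 | h0
    · exact Or.inl (Or.inl ⟨hu.1, h0⟩)
    · exact Or.inl (Or.inr h0)
    · exact Or.inr ⟨h0, hu.2⟩
  refine (lintegral_mono_set hsub).trans_lt ((lintegral_union_le _ _ _).trans_lt ?_)
  refine ENNReal.add_lt_top.2 ⟨(lintegral_union_le _ _ _).trans_lt ?_, h⟩
  exact ENNReal.add_lt_top.2 ⟨hneg, by simp⟩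

lemma lintegral_lintegral_kernel_lt_top (C : ℝ≥0∞) (hC : C ≠ ⊤) (R : ℝ) :
    ∫⁻ s in Set.Ioc 0 R, ∫⁻ s' in Set.Ioc 0 R, C * ‖s - s'‖ₑ ^ (-(1 / 2 : ℝ)) < ⊤ := by
  have hin : ∀ s ∈ Set.Ioc 0 R, ∫⁻ s' in Set.Ioc 0 R, C * ‖s - s'‖ₑ ^ (-(1 / 2 : ℝ)) ≤
      C * ∫⁻ u in Set.Icc (-R) R, ‖u‖ₑ ^ (-(1 / 2 : ℝ)) := by
    intro s hs
    rw [lintegral_const_mul' _ _ hC]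
    refine mul_le_mul' le_rfl ?_
    rw [← lintegral_indicator measurableSet_Ioc, ← lintegral_indicator measurableSet_Icc,
      ← lintegral_sub_left_eq_self
        ((Set.Icc (-R) R).indicator fun u : ℝ => ‖u‖ₑ ^ (-(1 / 2 : ℝ))) s]
    refine lintegral_mono fun s' => Set.indicator_apply_le' (fun hs' => ?_) fun _ => zero_le
    rw [Set.indicator_of_mem]
    exact ⟨by linarith [hs.1, hs'.2], by linarith [hs.2, hs'.1]⟩
  refine (setLIntegral_mono measurable_const hin).trans_lt ?_
  rw [setLIntegral_const]
  exact ENNReal.mul_lt_top (ENNReal.mul_lt_top hC.lt_top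
    (lintegral_enorm_rpow_neg_half_Icc_lt_top R)) (by simp)

/-- The truncated oscillatory kernel `l^{-1/4} e^{i(ls + t(s)(l²+q))}` on `l > max(B/s, 1)`. -/
noncomputable def oscKernel (B q : ℝ) (t : ℝ → ℝ) (s l : ℝ) : ℂ :=
  if B / s < l ∧ 1 < l then ((l ^ (-(1 / 4 : ℝ)) : ℝ) : ℂ) *
    Complex.exp (Complex.I * ((l * s + t s * (l ^ 2 + q) : ℝ) : ℂ)) else 0

lemma measurable_oscKernel (B q : ℝ) {t : ℝ → ℝ} (ht : Measurable t) :
    Measurable (Function.uncurry (oscKernel B q t)) := by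
  unfold oscKernel Function.uncurry
  refine Measurable.ite ?_ ?_ measurable_const
  · exact (measurableSet_lt (measurable_const.div measurable_fst) measurable_snd).inter
      (measurableSet_lt measurable_const measurable_snd)
  · have : Measurable fun z : ℝ × ℝ => t z.1 := ht.comp measurable_fst
    apply Measurable.mul
    · exact Complex.measurable_ofReal.comp (measurable_snd.pow_const _)
    · apply Complex.measurable_exp.comp
      apply Measurable.const_mul
      apply Complex.measurable_ofReal.comp
      fun_prop

lemma norm_oscKernel_le_one (B q : ℝ) (t : ℝ → ℝ) (s l : ℝ) : ‖oscKernel B q t s l‖ ≤ 1 := by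
  unfold oscKernel
  split_ifs with h
  · have h0 : 0 ≤ l := by linarith [h.2]
    rw [norm_mul, Complex.norm_exp_I_mul_ofReal, mul_one, Complex.norm_real,
      Real.norm_of_nonneg (Real.rpow_nonneg h0 _)]
    exact Real.rpow_le_one_of_one_le_of_nonpos h.2.le (by norm_num)
  · simp

open ComplexConjugate in
lemma enorm_integral_oscKernel_mul_conj_le (B q N : ℝ) (t : ℝ → ℝ) (s s' : ℝ) :
    ‖∫ l in Set.Ioc 1 N, oscKernel B q t s l * conj (oscKernel B q t s' l)‖ₑ ≤
      50 * ‖s - s'‖ₑ ^ (-(1 / 2 : ℝ)) := by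
  rcases eq_or_ne s s' with rfl | hss
  · simp [ENNReal.zero_rpow_of_neg]
  set α := max 1 (max (B / s) (B / s')) with hα
  have hα1 : 1 ≤ α := le_max_left _ _
  have heq : (fun l => oscKernel B q t s l * conj (oscKernel B q t s' l)) =
      (Set.Ioi α).indicator (fun l => ((l ^ (-(1 / 2 : ℝ)) : ℝ) : ℂ) *
        Complex.exp (Complex.I * (((s - s') * l + (t s - t s') * (l ^ 2 + q) : ℝ) : ℂ))) := by
    ext l
    by_cases hl : α < l
    · rw [Set.indicator_of_mem (Set.mem_Ioi.2 hl)]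
      simp only [hα, max_lt_iff] at hl
      unfold oscKernel
      rw [if_pos ⟨hl.2.1, hl.1⟩, if_pos ⟨hl.2.2, hl.1⟩, map_mul, Complex.conj_ofReal,
        ← Complex.exp_conj, map_mul, Complex.conj_I, Complex.conj_ofReal, mul_mul_mul_comm,
        ← Complex.exp_add, ← Complex.ofReal_mul, ← Real.rpow_add (by linarith)]
      congr 2
      · norm_num
      · push_cast; ring
    · rw [Set.indicator_of_notMem (by simpa using hl)]
      simp only [hα, max_lt_iff, not_and_or] at hl
      unfold oscKernel
      rcases hl with hl | hl | hl <;> simp [hl]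
  rw [heq, setIntegral_indicator measurableSet_Ioi, Set.Ioc_inter_Ioi, sup_eq_right.2 hα1]
  rcases le_or_gt α N with hN | hN
  · have h := norm_oscInt_le (x := s - s') (t s - t s') q (sub_ne_zero.2 hss)
      (by linarith : 0 < α) hN
    rw [oscInt, intervalIntegral.integral_of_le hN] at h
    have hx : 0 < |s - s'| := abs_pos.2 (sub_ne_zero.2 hss)
    rw [← ofReal_norm, ← ofReal_norm, Real.norm_eq_abs (s - s'), ENNReal.ofReal_rpow_of_pos hx,
      Real.rpow_neg hx.le, ← Real.sqrt_eq_rpow,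
      show (50 : ℝ≥0∞) = ENNReal.ofReal 50 by simp, ← ENNReal.ofReal_mul (by norm_num)]
    exact ENNReal.ofReal_le_ofReal h
  · simp [Set.Ioc_eq_empty_of_le hN.le]

/-- The input function normalised so that the truncated kernel acts on it. -/
noncomputable def normalizedInput (mv mz : ℕ) (g : ℝ → ℂ) (l : ℝ) : ℂ :=
  ((l ^ (1 / 4 : ℝ) * l ^ (-(((mv : ℝ) + (mz : ℝ) + 1 - 1) / 2)) : ℝ) : ℂ) * g l *
    ((plancherelWeight mv mz l : ℝ) : ℂ)

lemma measurable_normalizedInput (mv mz : ℕ) {g : ℝ → ℂ} (hg : Measurable g) :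
    Measurable (normalizedInput mv mz g) := by
  unfold normalizedInput plancherelWeight
  apply Measurable.mul (Measurable.mul _ hg)
  · apply Complex.measurable_ofReal.comp; fun_prop
  · apply Complex.measurable_ofReal.comp; fun_prop

lemma plancherelWeight_le {mv mz : ℕ} (hmv : 2 ≤ mv) {l : ℝ} (hl : 1 < l) :
    plancherelWeight mv mz l ≤ 2 ^ (mv + mz) * l ^ ((mv : ℝ) + mz) := by
  have h0 : 0 < l := by linarith
  have hmv' : (2 : ℝ) ≤ mv := by exact_mod_cast hmv
  have hmz' : (0 : ℝ) ≤ mz := by positivity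
  unfold plancherelWeight
  have h1 : (1 + l) ^ ((mv : ℝ) + (mz : ℝ) + 1 - 3) ≤ (2 * l) ^ ((mv : ℝ) + (mz : ℝ) + 1 - 3) :=
    Real.rpow_le_rpow (by linarith) (by linarith) (by linarith)
  have h2 : (2 : ℝ) ^ ((mv : ℝ) + (mz : ℝ) + 1 - 3) ≤ 2 ^ (mv + mz) := by
    rw [← Real.rpow_natCast]
    exact Real.rpow_le_rpow_of_exponent_le (by norm_num) (by push_cast; linarith)
  rw [Real.mul_rpow (by norm_num) h0.le] at h1
  calc _ ≤ l ^ 2 * (2 ^ (mv + mz) * l ^ ((mv : ℝ) + (mz : ℝ) + 1 - 3)) := by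
        refine mul_le_mul_of_nonneg_left (h1.trans ?_) (sq_nonneg _)
        exact mul_le_mul_of_nonneg_right h2 (Real.rpow_nonneg h0.le _)
    _ = 2 ^ (mv + mz) * (l ^ (2 : ℝ) * l ^ ((mv : ℝ) + (mz : ℝ) + 1 - 3)) := by
        rw [Real.rpow_two]; ring
    _ = _ := by
        rw [← Real.rpow_add h0]; congr 2; ring

lemma enorm_normalizedInput_sq_le {mv mz : ℕ} (hmv : 2 ≤ mv) {q : ℝ} (hq : 0 ≤ q) (g : ℝ → ℂ)
    {l : ℝ} (hl : 1 < l) :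
    ‖normalizedInput mv mz g l‖ₑ ^ 2 ≤ 2 ^ (mv + mz) *
      (ENNReal.ofReal ((l ^ 2 + q) ^ ((1 : ℝ) / 4)) * (‖g l‖₊ : ℝ≥0∞) ^ 2 *
        ENNReal.ofReal (plancherelWeight mv mz l)) := by
  have h0 : 0 < l := by linarith
  have hw0 : 0 ≤ plancherelWeight mv mz l :=
    mul_nonneg (sq_nonneg _) (Real.rpow_nonneg (by linarith) _)
  set w := plancherelWeight mv mz l with hw
  set d : ℝ := (mv : ℝ) + mz with hd
  have e1 : (l ^ (1 / 4 : ℝ)) ^ 2 ≤ (l ^ 2 + q) ^ ((1 : ℝ) / 4) := by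
    calc (l ^ (1 / 4 : ℝ)) ^ 2 = (l ^ 2) ^ ((1 : ℝ) / 4) := by
          rw [← Real.rpow_natCast, ← Real.rpow_natCast, ← Real.rpow_mul h0.le,
            ← Real.rpow_mul h0.le]
          norm_num
      _ ≤ _ := Real.rpow_le_rpow (sq_nonneg _) (by linarith) (by norm_num)
  have e2 : (l ^ (-((d + 1 - 1) / 2))) ^ 2 * w ≤ 2 ^ (mv + mz) := by
    have : (l ^ (-((d + 1 - 1) / 2))) ^ 2 = l ^ (-d) := by
      rw [← Real.rpow_natCast, ← Real.rpow_mul h0.le]; congr 1; push_cast; ring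
    rw [this]
    calc l ^ (-d) * w ≤ l ^ (-d) * (2 ^ (mv + mz) * l ^ d) :=
          mul_le_mul_of_nonneg_left (plancherelWeight_le hmv hl) (Real.rpow_nonneg h0.le _)
      _ = 2 ^ (mv + mz) * (l ^ (-d) * l ^ d) := by ring
      _ = _ := by rw [← Real.rpow_add h0]; simp
  have hn : ‖normalizedInput mv mz g l‖ =
      l ^ (1 / 4 : ℝ) * l ^ (-((d + 1 - 1) / 2)) * ‖g l‖ * w := by
    unfold normalizedInput
    rw [norm_mul, norm_mul, Complex.norm_real, Complex.norm_real, Real.norm_of_nonneg hw0,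
      Real.norm_of_nonneg (mul_nonneg (Real.rpow_nonneg h0.le _) (Real.rpow_nonneg h0.le _))]
  have hr : ‖normalizedInput mv mz g l‖ ^ 2 ≤
      2 ^ (mv + mz) * ((l ^ 2 + q) ^ ((1 : ℝ) / 4) * ‖g l‖ ^ 2 * w) := by
    rw [hn]
    calc _ = ((l ^ (-((d + 1 - 1) / 2))) ^ 2 * w) * ((l ^ (1 / 4 : ℝ)) ^ 2 * (‖g l‖ ^ 2 * w)) := by
          ring
      _ ≤ 2 ^ (mv + mz) * ((l ^ 2 + q) ^ ((1 : ℝ) / 4) * (‖g l‖ ^ 2 * w)) := by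
          gcongr
      _ = _ := by ring
  have h2 : (2 : ℝ≥0∞) ^ (mv + mz) = ENNReal.ofReal (2 ^ (mv + mz)) := by
    rw [ENNReal.ofReal_pow (by norm_num)]; simp
  have hg : (‖g l‖₊ : ℝ≥0∞) ^ 2 = ENNReal.ofReal (‖g l‖ ^ 2) := by
    rw [ENNReal.ofReal_pow (norm_nonneg _), ofReal_norm]; rfl
  rw [h2, hg, ← ENNReal.ofReal_mul (by positivity), ← ENNReal.ofReal_mul (by positivity),
    ← ENNReal.ofReal_mul (by positivity), ← ofReal_norm, ← ENNReal.ofReal_pow (norm_nonneg _)]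
  exact ENNReal.ofReal_le_ofReal hr

lemma integrable_of_lintegral_enorm_sq_lt_top {ν : Measure ℝ} [IsFiniteMeasure ν] {G : ℝ → ℂ}
    (hG : Measurable G) (h : ∫⁻ l, ‖G l‖ₑ ^ 2 ∂ν < ⊤) : Integrable G ν := by
  have : MemLp G 2 ν := by
    refine ⟨hG.aestronglyMeasurable, ?_⟩
    rw [eLpNorm_lt_top_iff_lintegral_rpow_enorm_lt_top (by norm_num) (by norm_num)]
    simpa using h
  exact this.integrable (by norm_num)

lemma enorm_integral_le_liminf {f : ℝ → ℂ} {a : ℝ} :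
    ‖∫ l in Set.Ioi a, f l‖ₑ ≤
      Filter.liminf (fun N : ℕ => ‖∫ l in Set.Ioc a (N : ℝ), f l‖ₑ) Filter.atTop := by
  by_cases hf : IntegrableOn f (Set.Ioi a)
  · have h := (aecover_Iic (μ := volume.restrict (Set.Ioi a))
      (tendsto_natCast_atTop_atTop (R := ℝ))).integral_tendsto_of_countably_generated hf
    simp only [Measure.restrict_restrict measurableSet_Iic, Set.Iic_inter_Ioi] at h
    exact h.enorm.liminf_eq.ge
  · rw [integral_undef hf]; simp

lemma exists_radialDensity_rpow_le (mv mz : ℕ) (R : ℝ) :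
    ∃ D : ℝ, ∀ s ∈ Set.Ioc 0 R, radialDensity mv mz s ^ ((1 : ℝ) / 2) ≤ D := by
  have hc : Continuous fun s => radialDensity mv mz s ^ ((1 : ℝ) / 2) := by
    apply Continuous.rpow_const _ (fun _ => Or.inr (by norm_num))
    unfold radialDensity
    fun_prop
  obtain ⟨D, hD⟩ := (isCompact_Icc (a := (0 : ℝ)) (b := R)).exists_bound_of_continuousOn
    hc.continuousOn
  exact ⟨D, fun s hs => (le_abs_self _).trans (hD s ⟨hs.1.le, hs.2⟩)⟩

lemma integral_Ioc_oscKernel_eq {B R q N s : ℝ} (hBR : R < B) (hs : s ∈ Set.Ioc 0 R)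
    (mv mz : ℕ) (t : ℝ → ℝ) (g : ℝ → ℂ) :
    ∫ l in Set.Ioc 1 N, oscKernel B q t s l * normalizedInput mv mz g l =
      ∫ l in Set.Ioc (B / s) N, ((l ^ (-(((mv : ℝ) + (mz : ℝ) + 1 - 1) / 2)) : ℝ) : ℂ) *
        Complex.exp (Complex.I * ((l * s + t s * (l ^ 2 + q) : ℝ) : ℂ)) *
        g l * ((plancherelWeight mv mz l : ℝ) : ℂ) := by
  have hBs : 1 < B / s := by rw [lt_div_iff₀ hs.1]; linarith [hs.2]
  have heq : (fun l => oscKernel B q t s l * normalizedInput mv mz g l) =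
      (Set.Ioi (B / s)).indicator fun l =>
        ((l ^ (-(((mv : ℝ) + (mz : ℝ) + 1 - 1) / 2)) : ℝ) : ℂ) *
        Complex.exp (Complex.I * ((l * s + t s * (l ^ 2 + q) : ℝ) : ℂ)) *
        g l * ((plancherelWeight mv mz l : ℝ) : ℂ) := by
    ext l
    by_cases hl : B / s < l
    · have hl1 : 1 < l := hBs.trans hl
      rw [Set.indicator_of_mem (Set.mem_Ioi.2 hl)]
      unfold oscKernel normalizedInput
      rw [if_pos ⟨hl, hl1⟩]
      have h1 : ((l ^ (-(1 / 4 : ℝ)) : ℝ) : ℂ) * ((l ^ (1 / 4 : ℝ) : ℝ) : ℂ) = 1 := by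
        rw [← Complex.ofReal_mul, ← Real.rpow_add (by linarith)]; simp
      rw [Complex.ofReal_mul (l ^ (1 / 4 : ℝ))]
      linear_combination (((l ^ (-(((mv : ℝ) + (mz : ℝ) + 1 - 1) / 2)) : ℝ) : ℂ) *
        Complex.exp (Complex.I * ((l * s + t s * (l ^ 2 + q) : ℝ) : ℂ)) *
        g l * ((plancherelWeight mv mz l : ℝ) : ℂ)) * h1
    · rw [Set.indicator_of_notMem (by simpa using hl)]
      simp [oscKernel, hl]
  rw [heq, setIntegral_indicator measurableSet_Ioi, Set.Ioc_inter_Ioi, sup_eq_right.2 hBs.le]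

/-- **Estimate for the oscillatory main term `T₃` near the identity.**
Let `mv` be a positive even integer, `mz` a positive integer, `n = mv + mz + 1`,
`Q = mv/2 + mz`, `B > 2`, `0 < R₀ < 2`. There is `c > 0` (depending only on `mv`, `mz`, `B`,
`R₀`) such that for every measurable `t : (0,∞) → (0, 4/Q²)` and every measurable
`g : (0,∞) → ℂ` with finite `H^{1/4}`-integral:
`∫_0^{R₀} A(s)^{1/2} |∫_{B/s}^∞ λ^{-(n-1)/2} e^{i(λs + t(s)(λ²+Q²/4))} g(λ) w(λ) dλ| ds
  ≤ c (∫_0^∞ (λ²+Q²/4)^{1/4} |g(λ)|² w(λ) dλ)^{1/2}`. -/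
theorem main_term_estimate_near_identity
    (mv mz : ℕ) (hmv : 0 < mv) (hmv_even : Even mv) (hmz : 0 < mz)
    (B R₀ : ℝ) (hB : 2 < B) (hR₀ : 0 < R₀) (hR₀' : R₀ < 2) :
    ∃ c : ℝ, 0 < c ∧
      ∀ t : ℝ → ℝ, Measurable t →
        (∀ u : ℝ, 0 < u → t u ∈ Set.Ioo 0 (4 / homDim mv mz ^ 2)) →
      ∀ g : ℝ → ℂ, Measurable g →
      (∫⁻ l in Set.Ioi (0:ℝ),
          ENNReal.ofReal ((l ^ 2 + homDim mv mz ^ 2 / 4) ^ ((1:ℝ)/4)) *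
            (‖g l‖₊ : ℝ≥0∞) ^ 2 * ENNReal.ofReal (plancherelWeight mv mz l)) < ⊤ →
      (∫⁻ s in Set.Ioc (0:ℝ) R₀,
          ENNReal.ofReal (radialDensity mv mz s ^ ((1:ℝ)/2)) *
            (‖∫ l in Set.Ioi (B / s),
                ((l ^ (-(((mv : ℝ) + (mz : ℝ) + 1 - 1) / 2)) : ℝ) : ℂ) *
                  Complex.exp (Complex.I *
                    ((l * s + t s * (l ^ 2 + homDim mv mz ^ 2 / 4) : ℝ) : ℂ)) *
                  g l * ((plancherelWeight mv mz l : ℝ) : ℂ)‖₊ : ℝ≥0∞))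
        ≤ ENNReal.ofReal c *
            (∫⁻ l in Set.Ioi (0:ℝ),
                ENNReal.ofReal ((l ^ 2 + homDim mv mz ^ 2 / 4) ^ ((1:ℝ)/4)) *
                  (‖g l‖₊ : ℝ≥0∞) ^ 2 * ENNReal.ofReal (plancherelWeight mv mz l))
              ^ ((1:ℝ)/2) := by
  have hmv2 : 2 ≤ mv := by obtain ⟨k, hk⟩ := hmv_even; omega
  obtain ⟨D, hD⟩ := exists_radialDensity_rpow_le mv mz R₀
  set K : ℝ≥0∞ := ∫⁻ s in Set.Ioc 0 R₀, ∫⁻ s' in Set.Ioc 0 R₀,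
    50 * ‖s - s'‖ₑ ^ (-(1 / 2 : ℝ)) with hK
  have hKtop : K < ⊤ := lintegral_lintegral_kernel_lt_top 50 (by norm_num) R₀
  set C : ℝ≥0∞ := ENNReal.ofReal D * (K ^ (1 / 2 : ℝ) * (2 ^ (mv + mz)) ^ (1 / 2 : ℝ)) with hC
  have hCtop : C ≠ ⊤ := by
    refine ENNReal.mul_ne_top ENNReal.ofReal_ne_top (ENNReal.mul_ne_top ?_ ?_)
    · exact ENNReal.rpow_ne_top_of_nonneg (by norm_num) hKtop.ne
    · exact ENNReal.rpow_ne_top_of_nonneg (by norm_num) (by simp)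
  refine ⟨C.toReal + 1, by positivity, fun t ht _ g hg hfin => ?_⟩
  set q : ℝ := homDim mv mz ^ 2 / 4 with hq
  have hq0 : 0 ≤ q := by positivity
  set E : ℝ≥0∞ := ∫⁻ l in Set.Ioi (0:ℝ), ENNReal.ofReal ((l ^ 2 + q) ^ ((1:ℝ)/4)) *
    (‖g l‖₊ : ℝ≥0∞) ^ 2 * ENNReal.ofReal (plancherelWeight mv mz l) with hE
  have hGm := measurable_normalizedInput mv mz hg
  have hGE : ∀ N : ℝ, ∫⁻ l in Set.Ioc 1 N, ‖normalizedInput mv mz g l‖ₑ ^ 2 ≤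
      2 ^ (mv + mz) * E := by
    intro N
    rw [hE, ← lintegral_const_mul' _ _ (by simp)]
    refine (setLIntegral_mono' measurableSet_Ioc fun l hl =>
      enorm_normalizedInput_sq_le hmv2 hq0 g hl.1).trans (lintegral_mono_set ?_)
    exact fun l hl => zero_lt_one.trans hl.1
  have hGi : ∀ N : ℝ, IntegrableOn (normalizedInput mv mz g) (Set.Ioc 1 N) := fun N =>
    integrable_of_lintegral_enorm_sq_lt_top hGm
      ((hGE N).trans_lt (ENNReal.mul_lt_top (by simp) hfin))
  set F : ℕ → ℝ → ℂ := fun N s =>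
    ∫ l in Set.Ioc 1 (N : ℝ), oscKernel B q t s l * normalizedInput mv mz g l with hF
  have hFm : ∀ N, Measurable fun s => ‖F N s‖ₑ := fun N => by
    refine (StronglyMeasurable.integral_prod_right
      (f := fun s l => oscKernel B q t s l * normalizedInput mv mz g l) ?_).enorm
    exact ((measurable_oscKernel B q ht).mul (hGm.comp measurable_snd)).stronglyMeasurable
  have hFb : ∀ N, ∫⁻ s in Set.Ioc 0 R₀, ‖F N s‖ₑ ≤
      K ^ (1 / 2 : ℝ) * (2 ^ (mv + mz) * E) ^ (1 / 2 : ℝ) := fun N => by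
    refine (lintegral_enorm_integral_le (measurable_oscKernel B q ht)
      (norm_oscKernel_le_one B q t) (enorm_integral_oscKernel_mul_conj_le B q N t)
      (hGi N) hGm).trans ?_
    gcongr
    exact hGE N
  calc _ ≤ ∫⁻ s in Set.Ioc 0 R₀, ENNReal.ofReal D *
        Filter.liminf (fun N => ‖F N s‖ₑ) Filter.atTop := by
        refine setLIntegral_mono' measurableSet_Ioc fun s hs => ?_
        refine mul_le_mul' (ENNReal.ofReal_le_ofReal (hD s hs)) ?_
        simp only [hF, integral_Ioc_oscKernel_eq (hR₀'.trans hB) hs]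
        exact enorm_integral_le_liminf
    _ = ENNReal.ofReal D * ∫⁻ s in Set.Ioc 0 R₀,
        Filter.liminf (fun N => ‖F N s‖ₑ) Filter.atTop :=
        lintegral_const_mul' _ _ ENNReal.ofReal_ne_top
    _ ≤ ENNReal.ofReal D * (K ^ (1 / 2 : ℝ) * (2 ^ (mv + mz) * E) ^ (1 / 2 : ℝ)) := by
        refine mul_le_mul' le_rfl ((lintegral_liminf_le hFm).trans ?_)
        exact Filter.liminf_le_of_frequently_le' (Filter.Frequently.of_forall hFb)
    _ = C * E ^ (1 / 2 : ℝ) := by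
        rw [ENNReal.mul_rpow_of_nonneg _ _ (by norm_num), hC]; ring
    _ ≤ ENNReal.ofReal (C.toReal + 1) * E ^ ((1 : ℝ) / 2) := by
        gcongr
        rw [← ENNReal.ofReal_toReal hCtop, ENNReal.toReal_ofReal ENNReal.toReal_nonneg]
        exact ENNReal.ofReal_le_ofReal (by linarith)
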